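/- arXiv:2409.04957 — 2 statements merged into one kernel-verified Lean document; each statement's English description precedes it below -/
import Mathlib

section
/- Let K be a commutative semiring. Let A and B be finite posets with distinguished elements a ∈ A and b ∈ B, let m ≥ 2, let 1 ≤ k ≤ m−1, let σ₁, …, σ_m be fresh elements, and fix a weight function w on A ∪ B ∪ {σ₁, …, σ_m} with values in K. Define three configurations by generating relations: P₁ on A ∪ {σ₁, …, σ_m} with the order of A, the chain σ₁ ≺ σ₂ ≺ ⋯ ≺ σ_m, and σ₁ ≺ a, a ≺ σ_m; P₃ on A ∪ {σ₁, …, σ_k} ∪ B with the orders of A and of B, the chain σ₁ ≺ ⋯ ≺ σ_k, and σ₁ ≺ a, b ≺ σ_k; P₄ on A ∪ {σ_{k+1}, …, σ_m} ∪ B with the orders of A and of B, the chain σ_{k+1} ≺ ⋯ ≺ σ_m, and a ≺ σ_m, σ_{k+1} ≺ b. Then Z(P₁) · Z(B) = Z(P₃) + (∏_{i=1}^{k} w(σ_i)) · Z(P₄), where Z(B) is the sum over lower sets of B of the product of the weights of their elements. -/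
/-!
The combinatorial content of Proposition 4.1(2), case k ≠ 0, m, of the paper, in the
down-set formalism: the skein relation
`Z(P₁) · Z(B) = Z(P₃) + (∏_{i=1}^{k} w(σ_i)) · Z(P₄)`
for a singly-notched arc and an incompatible plain arc at a puncture.
-/

attribute [local instance] Classical.propDecidable

noncomputable section

/-- The ideal sum of a configuration: the sum, over all down-sets `S` of the ground set
(`S ⊆ ground`, closed under the generating relations: `rel x y` with `x ∈ ground` and
`y ∈ S` implies `x ∈ S`), of the product of the weights of the elements of `S`. -/
def idealSum {α K : Type*} [CommSemiring K]
    (ground : Finset α) (rel : α → α → Prop) (w : α → K) : K :=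
  ∑ S ∈ ground.powerset.filter
      (fun S => ∀ x ∈ ground, ∀ y ∈ S, rel x y → x ∈ S),
    ∏ x ∈ S, w x

/-- The generating chain `f lo ≺ f (lo+1) ≺ ⋯ ≺ f hi`. -/
def chainRel {α : Type*} (f : ℕ → α) (lo hi : ℕ) : α → α → Prop :=
  fun p q => ∃ i, lo ≤ i ∧ i + 1 ≤ hi ∧ p = f i ∧ q = f (i + 1)

/-- The single generating relation `u ≺ v`. -/
def covRel {α : Type*} (u v : α) : α → α → Prop := fun p q => p = u ∧ q = v

/-- The order of a poset `P`, transported along `f`. -/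
def posetRel {P α : Type*} [PartialOrder P] (f : P → α) : α → α → Prop :=
  fun p q => ∃ x y : P, x ≤ y ∧ p = f x ∧ q = f y

/-- The elements `f lo, …, f hi`. -/
def natGround {α : Type*} (f : ℕ → α) (lo hi : ℕ) : Finset α := (Finset.Icc lo hi).image f

/-- All the elements of the finite poset `P`, transported along `f`. -/
def posetGround {P α : Type*} [Fintype P] (f : P → α) : Finset α := Finset.univ.image f

/-- Embedding of the tail poset `A`. -/
def eA (A B : Type*) : A → A ⊕ (B ⊕ ℕ) := Sum.inl

/-- Embedding of the poset `B` of the second arc. -/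
def eB (A B : Type*) : B → A ⊕ (B ⊕ ℕ) := fun y => Sum.inr (Sum.inl y)

/-- The fresh elements `σ₁, …, σ_m` (the spokes at the puncture). -/
def eS (A B : Type*) : ℕ → A ⊕ (B ⊕ ℕ) := fun i => Sum.inr (Sum.inr i)

/-- A subset of `{lo + 1, …, hi}` closed under the covering relations of the chain is an initial
segment. -/
lemma exists_eq_Icc_of_chain_closed {lo hi : ℕ} (hlo : lo ≤ hi) {N : Finset ℕ}
    (hN : N ⊆ Finset.Icc (lo + 1) hi)
    (hc : ∀ i, lo + 1 ≤ i → i + 1 ≤ hi → i + 1 ∈ N → i ∈ N) :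
    ∃ j ∈ Finset.Icc lo hi, N = Finset.Icc (lo + 1) j := by
  rcases N.eq_empty_or_nonempty with rfl | hne
  · exact ⟨lo, by simp [hlo], by simp⟩
  · have hmax := N.max'_mem hne
    have hb := Finset.mem_Icc.mp (hN hmax)
    refine ⟨N.max' hne, Finset.mem_Icc.mpr ⟨by omega, hb.2⟩, ?_⟩
    ext i
    refine ⟨fun hi => Finset.mem_Icc.mpr ⟨(Finset.mem_Icc.mp (hN hi)).1, N.le_max' i hi⟩,
      fun hi => ?_⟩
    obtain ⟨h1, h2⟩ := Finset.mem_Icc.mp hi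
    have key : ∀ d, i + d ∈ N → i ∈ N := by
      intro d
      induction d with
      | zero => exact id
      | succ d ih =>
        intro h
        exact ih (hc (i + d) (by omega) (Finset.mem_Icc.mp (hN h)).2 h)
    exact key (N.max' hne - i) (by rwa [Nat.add_sub_cancel' h2])

/-- The lower sets of a poset that are contained in a given finite set. -/
def lowerSetsIn {P : Type*} [PartialOrder P] (T : Finset P) : Finset (Finset P) :=
  T.powerset.filter fun I => IsLowerSet (I : Set P)

lemma lowerSetsIn_empty {P : Type*} [PartialOrder P] :
    lowerSetsIn (∅ : Finset P) = {∅} := by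
  ext I
  simp only [lowerSetsIn, Finset.powerset_empty, Finset.mem_filter, Finset.mem_singleton]
  refine ⟨fun h => h.1, ?_⟩
  rintro rfl
  simp [isLowerSet_empty]

/-- An ideal sum on the disjoint union of two posets and a chain, written as a sum over lower sets
of the posets and initial segments of the chain subject to a compatibility condition. -/
lemma idealSum_eq_sum_lowerSetsIn {K A B : Type*} [CommSemiring K]
    [PartialOrder A] [PartialOrder B] (wA : A → K) (wB : B → K) (s : ℕ → K)
    (TA : Finset A) (TB : Finset B) {lo hi : ℕ} (hlo : lo ≤ hi)
    (G : Finset (A ⊕ (B ⊕ ℕ))) (R : A ⊕ (B ⊕ ℕ) → A ⊕ (B ⊕ ℕ) → Prop)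
    (Q : Finset A → Finset B → Finset ℕ → Prop)
    (hG : G = TA.disjSum (TB.disjSum (Finset.Icc (lo + 1) hi)))
    (hR : ∀ I ⊆ TA, ∀ J ⊆ TB, ∀ N ⊆ Finset.Icc (lo + 1) hi,
      (∀ x ∈ G, ∀ y ∈ I.disjSum (J.disjSum N), R x y → x ∈ I.disjSum (J.disjSum N)) ↔
        IsLowerSet (I : Set A) ∧ IsLowerSet (J : Set B) ∧
          (∀ i, lo + 1 ≤ i → i + 1 ≤ hi → i + 1 ∈ N → i ∈ N) ∧ Q I J N) :
    idealSum G R (Sum.elim wA (Sum.elim wB s)) =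
      ∑ I ∈ lowerSetsIn TA, ∑ J ∈ lowerSetsIn TB, ∑ j ∈ Finset.Icc lo hi,
        if Q I J (Finset.Icc (lo + 1) j) then
          (∏ x ∈ I, wA x) * (∏ y ∈ J, wB y) * ∏ i ∈ Finset.Icc (lo + 1) j, s i
        else 0 := by
  have hsub : ∀ (I : Finset A) (J : Finset B) (N : Finset ℕ),
      I.disjSum (J.disjSum N) ⊆ G ↔ I ⊆ TA ∧ J ⊆ TB ∧ N ⊆ Finset.Icc (lo + 1) hi := by
    intro I J N
    subst hG
    simp only [Finset.subset_iff, Sum.forall, Finset.inl_mem_disjSum, Finset.inr_mem_disjSum]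
  have hIcc : ∀ j ≤ hi, Finset.Icc (lo + 1) j ⊆ Finset.Icc (lo + 1) hi :=
    fun j hj => Finset.Icc_subset_Icc le_rfl hj
  simp_rw [← Finset.sum_product']
  rw [← Finset.sum_filter]
  symm
  unfold idealSum
  refine Finset.sum_bij
    (fun t _ => t.1.disjSum (t.2.1.disjSum (Finset.Icc (lo + 1) t.2.2))) ?_ ?_ ?_ ?_
  · rintro ⟨I, J, j⟩ h
    simp only [lowerSetsIn, Finset.mem_filter, Finset.mem_product, Finset.mem_powerset,
      Finset.mem_Icc] at h
    obtain ⟨⟨⟨hI, hI'⟩, ⟨hJ, hJ'⟩, hj, hj'⟩, hQ⟩ := h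
    simp only [Finset.mem_filter, Finset.mem_powerset]
    refine ⟨(hsub _ _ _).mpr ⟨hI, hJ, hIcc j hj'⟩,
      (hR I hI J hJ _ (hIcc j hj')).mpr ⟨hI', hJ', ?_, hQ⟩⟩
    intro i h1 _ h3
    simp only [Finset.mem_Icc] at h3 ⊢
    omega
  · rintro ⟨I, J, j⟩ h ⟨I', J', j'⟩ h' heq
    simp only [Finset.mem_filter, Finset.mem_product, Finset.mem_Icc] at h h'
    have h1 : I = I' := by simpa using congrArg Finset.toLeft heq
    have h2 : J = J' := by simpa using congrArg (fun S => S.toRight.toLeft) heq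
    have h3 : Finset.Icc (lo + 1) j = Finset.Icc (lo + 1) j' := by
      simpa using congrArg (fun S => S.toRight.toRight) heq
    have h4 := congrArg Finset.card h3
    simp only [Nat.card_Icc] at h4
    have h5 : j = j' := by omega
    rw [h1, h2, h5]
  · intro S hS
    obtain ⟨I, J, N, rfl⟩ : ∃ I J N, S = Finset.disjSum I (Finset.disjSum J N) :=
      ⟨S.toLeft, S.toRight.toLeft, S.toRight.toRight, by
        rw [Finset.toLeft_disjSum_toRight, Finset.toLeft_disjSum_toRight]⟩
    simp only [Finset.mem_filter, Finset.mem_powerset] at hS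
    obtain ⟨hS, hd⟩ := hS
    obtain ⟨hI, hJ, hN⟩ := (hsub I J N).mp hS
    obtain ⟨hI', hJ', hc, hQ⟩ := (hR I hI J hJ N hN).mp hd
    obtain ⟨j, hj, rfl⟩ := exists_eq_Icc_of_chain_closed hlo hN hc
    refine ⟨(I, J, j), ?_, rfl⟩
    simp only [lowerSetsIn, Finset.mem_filter, Finset.mem_product, Finset.mem_powerset]
    exact ⟨⟨⟨hI, hI'⟩, ⟨hJ, hJ'⟩, hj⟩, hQ⟩
  · rintro ⟨I, J, j⟩ _
    simp [Finset.prod_disjSum, mul_assoc]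

theorem skein_notched_plain_at_puncture
    (K : Type*) [CommSemiring K]
    (A B : Type*) [Fintype A] [PartialOrder A] [Fintype B] [PartialOrder B]
    (a : A) (b : B)
    (m k : ℕ) (hm : 2 ≤ m) (hk1 : 1 ≤ k) (hk2 : k ≤ m - 1)
    (wA : A → K) (wB : B → K) (s : ℕ → K) :
    idealSum
        (posetGround (eA A B) ∪ natGround (eS A B) 1 m)
        (posetRel (eA A B) ⊔ chainRel (eS A B) 1 m ⊔
          covRel (eS A B 1) (eA A B a) ⊔ covRel (eA A B a) (eS A B m))
        (Sum.elim wA (Sum.elim wB s)) *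
      idealSum (posetGround (eB A B)) (posetRel (eB A B)) (Sum.elim wA (Sum.elim wB s))
    = idealSum
        (posetGround (eA A B) ∪ natGround (eS A B) 1 k ∪ posetGround (eB A B))
        (posetRel (eA A B) ⊔ posetRel (eB A B) ⊔ chainRel (eS A B) 1 k ⊔
          covRel (eS A B 1) (eA A B a) ⊔ covRel (eB A B b) (eS A B k))
        (Sum.elim wA (Sum.elim wB s))
      + (∏ i ∈ Finset.Icc 1 k, s i) *
        idealSum
          (posetGround (eA A B) ∪ natGround (eS A B) (k + 1) m ∪ posetGround (eB A B))
          (posetRel (eA A B) ⊔ posetRel (eB A B) ⊔ chainRel (eS A B) (k + 1) m ⊔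
            covRel (eA A B a) (eS A B m) ⊔ covRel (eS A B (k + 1)) (eB A B b))
          (Sum.elim wA (Sum.elim wB s)) := by
  rw [idealSum_eq_sum_lowerSetsIn wA wB s Finset.univ ∅ (Nat.zero_le m) _ _
      (fun I _ N => (a ∈ I → 1 ∈ N) ∧ (m ∈ N → a ∈ I)) ?_ ?_,
    idealSum_eq_sum_lowerSetsIn wA wB s ∅ Finset.univ le_rfl (lo := 0) _ _
      (fun _ _ _ => True) ?_ ?_,
    idealSum_eq_sum_lowerSetsIn wA wB s Finset.univ Finset.univ (Nat.zero_le k) _ _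
      (fun I J N => (a ∈ I → 1 ∈ N) ∧ (k ∈ N → b ∈ J)) ?_ ?_,
    idealSum_eq_sum_lowerSetsIn wA wB s Finset.univ Finset.univ (show k ≤ m by omega) _ _
      (fun I J N => (m ∈ N → a ∈ I) ∧ (b ∈ J → k + 1 ∈ N)) ?_ ?_]
  · simp only [lowerSetsIn_empty, Finset.sum_singleton, Finset.Icc_self, Finset.prod_empty,
      if_true, mul_one, one_mul]
    rw [Finset.sum_mul_sum, Finset.mul_sum, ← Finset.sum_add_distrib]
    refine Finset.sum_congr rfl fun I _ => ?_
    rw [Finset.mul_sum, ← Finset.sum_add_distrib]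
    refine Finset.sum_congr rfl fun J _ => ?_
    have h3 : Finset.Icc 0 k = (Finset.Icc 0 m).filter (· ≤ k) := by
      ext j
      simp only [Finset.mem_filter, Finset.mem_Icc]
      omega
    have h4 : Finset.Icc k m = (Finset.Icc 0 m).filter (k ≤ ·) := by
      ext j
      simp only [Finset.mem_filter, Finset.mem_Icc]
      omega
    rw [h3, h4, Finset.sum_filter, Finset.sum_filter, Finset.mul_sum, Finset.sum_mul,
      ← Finset.sum_add_distrib]
    refine Finset.sum_congr rfl fun j hj => ?_
    have hj' := (Finset.mem_Icc.mp hj).2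
    simp only [zero_add, Finset.mem_Icc]
    have hprod : k ≤ j → ∏ i ∈ Finset.Icc 1 j, s i =
        (∏ i ∈ Finset.Icc 1 k, s i) * ∏ i ∈ Finset.Icc (k + 1) j, s i := by
      intro hkj
      simpa only [← Finset.Ico_add_one_right_eq_Icc] using
        (Finset.prod_Ico_consecutive s (show 1 ≤ k + 1 by omega) (by omega)).symm
    rw [show Finset.Icc 1 0 = (∅ : Finset ℕ) from rfl, Finset.prod_empty, mul_one]
    clear h3 h4
    by_cases hkj : k ≤ j
    · rw [hprod hkj]
      split_ifs <;> first | ring1 | (exfalso; clear hprod; grind)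
    · split_ifs <;> first | ring1 | (exfalso; clear hprod; grind)
  all_goals simp [Finset.ext_iff, posetGround, natGround, eA, eB, eS, posetRel, chainRel, covRel,
    IsLowerSet]
  · intro I J N hN
    constructor
    · intro h
      exact ⟨fun x y hxy hx => (h.1 y).1 x hx y hxy rfl, fun x y hxy hx => h.2.1 y x hx hxy,
        fun i h1 h2 h3 => (h.2.2 i h1 h2.le).2 _ h3 i h1 h2 rfl rfl,
        fun hmN => (h.1 a).2 m hmN rfl rfl,
        fun hb => (h.2.2 (k + 1) (by omega) (by omega)).1 b hb rfl rfl⟩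
    · rintro ⟨hA, hB, hc, h1, h2⟩
      refine ⟨fun x => ⟨?_, ?_⟩, fun x y hy hxy => hB hxy hy, fun i _ _ => ⟨?_, ?_⟩⟩
      · rintro y hy z hz rfl
        exact hA hz hy
      · rintro i hi rfl rfl
        exact h1 hi
      · rintro y hy rfl rfl
        exact h2 hy
      · rintro _ hi j hj hj' rfl rfl
        exact hc i hj hj' hi
  · intro I J N hN
    constructor
    · intro h
      exact ⟨fun x y hxy hx => h.1 y x hx hxy, fun x y hxy hx => (h.2.1 y).1 x hx y hxy rfl,
        fun i h1 h2 h3 => (h.2.2 i h1 h2.le).2 _ h3 h1 h2 rfl,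
        fun ha => (h.2.2 1 le_rfl hk1).1 a ha rfl rfl,
        fun hkN => (h.2.1 b).2 k hkN rfl rfl⟩
    · rintro ⟨hA, hB, hc, h1, h2⟩
      refine ⟨fun x y hy hxy => hA hxy hy, fun x => ⟨?_, ?_⟩, fun i _ _ => ⟨?_, ?_⟩⟩
      · rintro y hy z hz rfl
        exact hB hz hy
      · rintro i hi rfl rfl
        exact h2 hi
      · rintro y hy rfl rfl
        exact h1 hy
      · rintro _ hi hj hj' rfl
        exact hc i hj hj' hi
  · grind
  · intro I J hJ N hN
    constructor
    · intro h
      exact ⟨fun x y hxy hx => (h.1 y).1 x hx hxy, fun x y _ hx => absurd hx (hJ x),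
        fun i h1 h2 h3 => (h.2 i i h1 h2.le rfl).2 _ h3 i h1 h2 rfl rfl,
        fun ha => (h.2 1 1 le_rfl (by omega) rfl).1 a ha rfl rfl,
        fun hmN => (h.1 a).2 m hmN rfl rfl⟩
    · rintro ⟨hA, _, hc, h1, h2⟩
      refine ⟨fun x => ⟨fun y hy hxy => hA hxy hy, ?_⟩, fun i _ _ _ _ => ⟨?_, ?_⟩⟩
      · rintro i hi rfl rfl
        exact h2 hi
      · rintro y hy rfl rfl
        exact h1 hy
      · rintro _ hi j hj hj' rfl rfl
        exact hc i hj hj' hi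
end
end

section
/- Let K be a commutative semiring, t ≥ 1, and let R be a fence on r₁, …, r_t (for each 1 ≤ i < t one chosen generating relation, either r_i ≺ r_{i+1} or r_{i+1} ≺ r_i), with weights u_i = w(r_i); the same weights are used on every copy of R. Let A₁, B₁, A₂, B₂ be finite posets with distinguished elements a₁ ∈ A₁, b₁ ∈ B₁, a₂ ∈ A₂, b₂ ∈ B₂, all carrying weights in K. Define six configurations by generating relations (always including the orders of the tail posets involved and the fence relations of the copy of R involved): P₁ on A₁ ∪ R ∪ B₁ with a₁ ≺ r₁ and b₁ ≺ r_t (so R lies on top of P₁); P₂ on A₂ ∪ R ∪ B₂ with r₁ ≺ a₂ and r_t ≺ b₂ (so R lies on bottom of P₂); P₃ on A₁ ∪ R ∪ B₂ with a₁ ≺ r₁ and r_t ≺ b₂; P₄ on A₂ ∪ R ∪ B₁ with r₁ ≺ a₂ and b₁ ≺ r_t; P₅ on A₁ ∪ A₂ with a₂ ≺ a₁; P₆ on B₁ ∪ B₂ with b₂ ≺ b₁. Then Z(P₁) · Z(P₂) = Z(P₃) · Z(P₄) + (∏_{i=1}^{t} u_i) · Z(P₅) · Z(P₆). -/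
/-!
The combinatorial content of Proposition 5.1 of the paper (Type 0 transverse crossing),
generic case, in the down-set formalism: two posets `P₁`, `P₂` overlap along a common
fence `R` (on top of `P₁`, on bottom of `P₂`), with tails `A₁, B₁` and `A₂, B₂` attached
via their distinguished elements, and
`Z(P₁) · Z(P₂) = Z(P₃) · Z(P₄) + (∏ u_i) · Z(P₅) · Z(P₆)`.
-/

attribute [local instance] Classical.propDecidable

noncomputable section

/-- A fence on `f 1, …, f t`: for each `1 ≤ i < t` one chosen generating relation,
either `f i ≺ f (i+1)` (when `ε i = true`) or `f (i+1) ≺ f i` (when `ε i = false`). -/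
def fenceRel {α : Type*} (f : ℕ → α) (t : ℕ) (ε : ℕ → Bool) : α → α → Prop :=
  fun p q => ∃ i, 1 ≤ i ∧ i + 1 ≤ t ∧
    ((ε i = true ∧ p = f i ∧ q = f (i + 1)) ∨
     (ε i = false ∧ p = f (i + 1) ∧ q = f i))

/-- Embedding of the tail poset `A₁`. -/
def eA1 (A₁ B₁ A₂ B₂ : Type*) : A₁ → A₁ ⊕ (B₁ ⊕ (A₂ ⊕ (B₂ ⊕ ℕ))) := Sum.inl

/-- Embedding of the tail poset `B₁`. -/
def eB1 (A₁ B₁ A₂ B₂ : Type*) : B₁ → A₁ ⊕ (B₁ ⊕ (A₂ ⊕ (B₂ ⊕ ℕ))) :=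
  fun y => Sum.inr (Sum.inl y)

/-- Embedding of the tail poset `A₂`. -/
def eA2 (A₁ B₁ A₂ B₂ : Type*) : A₂ → A₁ ⊕ (B₁ ⊕ (A₂ ⊕ (B₂ ⊕ ℕ))) :=
  fun y => Sum.inr (Sum.inr (Sum.inl y))

/-- Embedding of the tail poset `B₂`. -/
def eB2 (A₁ B₁ A₂ B₂ : Type*) : B₂ → A₁ ⊕ (B₁ ⊕ (A₂ ⊕ (B₂ ⊕ ℕ))) :=
  fun y => Sum.inr (Sum.inr (Sum.inr (Sum.inl y)))

/-- The fence elements `r₁, …, r_t` of the overlap `R`. -/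
def eR (A₁ B₁ A₂ B₂ : Type*) : ℕ → A₁ ⊕ (B₁ ⊕ (A₂ ⊕ (B₂ ⊕ ℕ))) :=
  fun i => Sum.inr (Sum.inr (Sum.inr (Sum.inr i)))

section PowersetSums

variable {α β M : Type*}

/-- A sum over the subsets of a disjoint union is a double sum. -/
theorem sum_powerset_union_of_disjoint [AddCommMonoid M] {G H : Finset α} (h : Disjoint G H)
    (f : Finset α → M) :
    ∑ S ∈ (G ∪ H).powerset, f S = ∑ S ∈ G.powerset, ∑ T ∈ H.powerset, f (S ∪ T) := by
  rw [← Finset.sum_product']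
  refine Finset.sum_nbij' (fun S => (S ∩ G, S ∩ H)) (fun p => p.1 ∪ p.2) ?_ ?_ ?_ ?_ ?_
  · intro S _
    simp
  · rintro ⟨S, T⟩ hST
    simp only [Finset.mem_product, Finset.mem_powerset] at hST ⊢
    exact Finset.union_subset_union hST.1 hST.2
  · intro S hS
    rw [Finset.mem_powerset] at hS
    simp only [← Finset.inter_union_distrib_left]
    exact Finset.inter_eq_left.2 hS
  · rintro ⟨S, T⟩ hST
    simp only [Finset.mem_product, Finset.mem_powerset] at hST
    rw [Finset.disjoint_left] at h
    ext x
    · have h1 := @hST.1 x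
      have h2 := @hST.2 x
      have h3 := @h x
      simp only [Finset.mem_inter, Finset.mem_union]
      tauto
    · have h1 := @hST.1 x
      have h2 := @hST.2 x
      have h3 := @h x
      simp only [Finset.mem_inter, Finset.mem_union]
      tauto
  · intro S hS
    rw [Finset.mem_powerset] at hS
    rw [← Finset.inter_union_distrib_left, Finset.inter_eq_left.2 hS]

/-- The subsets of an injective image are the images of the subsets. -/
theorem sum_powerset_image_of_injective [AddCommMonoid M] {f : β → α} (hf : Function.Injective f)
    (G : Finset β) (g : Finset α → M) :
    ∑ S ∈ (G.image f).powerset, g S = ∑ S ∈ G.powerset, g (S.image f) := by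
  rw [Finset.powerset_image, Finset.sum_image]
  exact (Finset.image_injective hf).injOn

/-- Images under functions with disjoint ranges are disjoint. -/
theorem disjoint_image_image_of_forall_ne {β γ : Type*} {p : β → α} {q : γ → α}
    (hpq : ∀ x y, p x ≠ q y) (S : Finset β) (V : Finset γ) :
    Disjoint (S.image p) (V.image q) := by
  rw [Finset.disjoint_left]
  intro x hx hx'
  obtain ⟨y, -, rfl⟩ := Finset.mem_image.1 hx
  obtain ⟨z, -, hz⟩ := Finset.mem_image.1 hx'
  exact hpq y z hz.symm

end PowersetSums

section Tails

variable {P K : Type*} [Fintype P] [PartialOrder P] [CommSemiring K]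

/-- The sum of the weights of the down-sets of `P` satisfying the condition `c`. -/
def lowerSum (w : P → K) (c : Finset P → Prop) : K :=
  ∑ S : Finset P, if IsLowerSet (S : Set P) ∧ c S then ∏ x ∈ S, w x else 0

/-- The compatibility of a down-set of a tail attached via `a` with the presence `s` of the
adjacent fence element, the tail being attached below (`b = true`) or above (`b = false`). -/
def linkCond (b : Bool) (a : P) (s : Prop) (S : Finset P) : Prop :=
  if b then s → a ∈ S else a ∈ S → s

/-- The contribution of a tail, given the presence of the adjacent fence element. -/
def tailSum (w : P → K) (b : Bool) (a : P) (s : Prop) : K :=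
  lowerSum w (linkCond b a s)

theorem lowerSum_true (w : P → K) (a : P) :
    lowerSum w (fun _ => True) = lowerSum w (fun S => a ∈ S) + lowerSum w (fun S => a ∉ S) := by
  unfold lowerSum
  rw [← Finset.sum_add_distrib]
  refine Finset.sum_congr rfl fun S _ => ?_
  by_cases h : a ∈ S <;> simp [h]

theorem tailSum_below_true (w : P → K) (a : P) :
    tailSum w true a True = lowerSum w (fun S => a ∈ S) := by
  exact Finset.sum_congr rfl fun S _ => by congr 1; simp [linkCond]

theorem tailSum_below_false (w : P → K) (a : P) :
    tailSum w true a False = lowerSum w (fun S => a ∈ S) + lowerSum w (fun S => a ∉ S) := by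
  rw [← lowerSum_true]
  exact Finset.sum_congr rfl fun S _ => by congr 1; simp [linkCond]

theorem tailSum_above_true (w : P → K) (a : P) :
    tailSum w false a True = lowerSum w (fun S => a ∈ S) + lowerSum w (fun S => a ∉ S) := by
  rw [← lowerSum_true]
  exact Finset.sum_congr rfl fun S _ => by congr 1; simp [linkCond]

theorem tailSum_above_false (w : P → K) (a : P) :
    tailSum w false a False = lowerSum w (fun S => a ∉ S) := by
  exact Finset.sum_congr rfl fun S _ => by congr

end Tails

section Fence

variable {K : Type*} [CommSemiring K]

/-- Closure of `T` under the generating relations of the fence `1, …, t`. -/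
def FenceClosed (t : ℕ) (ε : ℕ → Bool) (T : Finset ℕ) : Prop :=
  ∀ i, 1 ≤ i → i + 1 ≤ t →
    (ε i = true → i + 1 ∈ T → i ∈ T) ∧ (ε i = false → i ∈ T → i + 1 ∈ T)

/-- The ideal sum of the fence `1, …, t` restricted to the down-sets satisfying `c`. -/
def fenceSum (u : ℕ → K) (t : ℕ) (ε : ℕ → Bool) (c : Finset ℕ → Prop) : K :=
  ∑ T ∈ (Finset.Icc 1 t).powerset, if FenceClosed t ε T ∧ c T then ∏ i ∈ T, u i else 0

/-- The contribution of the down-sets of the fence with prescribed presence of both ends. -/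
def fenceEnds (u : ℕ → K) (t : ℕ) (ε : ℕ → Bool) (s s' : Prop) : K :=
  fenceSum u t ε (fun T => (1 ∈ T ↔ s) ∧ (t ∈ T ↔ s'))

theorem fenceClosed_succ_iff {t : ℕ} (ht : 1 ≤ t) (ε : ℕ → Bool) (T : Finset ℕ) :
    FenceClosed (t + 1) ε T ↔ FenceClosed t ε T ∧
      (ε t = true → t + 1 ∈ T → t ∈ T) ∧ (ε t = false → t ∈ T → t + 1 ∈ T) := by
  constructor
  · exact fun h => ⟨fun i hi hit => h i hi (by omega), h t ht le_rfl⟩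
  · rintro ⟨h, h'⟩ i hi hit
    rcases Nat.lt_or_ge i t with hlt | hge
    · exact h i hi hlt
    · obtain rfl : i = t := by omega
      exact h'

theorem fenceClosed_insert_succ_iff (t : ℕ) (ε : ℕ → Bool) (T : Finset ℕ) :
    FenceClosed t ε (insert (t + 1) T) ↔ FenceClosed t ε T := by
  refine forall_congr' fun i => forall_congr' fun hi => forall_congr' fun hit => ?_
  have h1 : i ≠ t + 1 := by omega
  have h2 : i ≠ t := by omega
  simp [h1, h2]

theorem fenceEnds_succ {t : ℕ} (ht : 1 ≤ t) (u : ℕ → K) (ε : ℕ → Bool) (s : Prop) :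
    fenceEnds u (t + 1) ε s False =
        (if ε t = true then fenceEnds u t ε s False + fenceEnds u t ε s True
          else fenceEnds u t ε s False) ∧
      fenceEnds u (t + 1) ε s True =
        u (t + 1) * (if ε t = true then fenceEnds u t ε s True
          else fenceEnds u t ε s False + fenceEnds u t ε s True) := by
  have hIcc : Finset.Icc 1 (t + 1) = insert (t + 1) (Finset.Icc 1 t) := by
    ext i
    simp only [Finset.mem_insert, Finset.mem_Icc]
    omega
  have hnot : t + 1 ∉ Finset.Icc 1 t := by simp
  have h1t : t ≠ 0 := by omega
  constructor
  · unfold fenceEnds fenceSum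
    rw [hIcc, Finset.sum_powerset_insert hnot]
    split_ifs with hε
    · rw [← Finset.sum_add_distrib, ← Finset.sum_add_distrib]
      refine Finset.sum_congr rfl fun T hT => ?_
      have hT' : t + 1 ∉ T := fun h => hnot (Finset.mem_powerset.1 hT h)
      by_cases h : t ∈ T <;> simp [fenceClosed_succ_iff ht, hT', hε, h]
    · rw [← Finset.sum_add_distrib]
      refine Finset.sum_congr rfl fun T hT => ?_
      have hT' : t + 1 ∉ T := fun h => hnot (Finset.mem_powerset.1 hT h)
      by_cases h : t ∈ T <;> simp [fenceClosed_succ_iff ht, hT', hε, h]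
  · unfold fenceEnds fenceSum
    rw [hIcc, Finset.sum_powerset_insert hnot]
    split_ifs with hε
    · rw [← Finset.sum_add_distrib, Finset.mul_sum]
      refine Finset.sum_congr rfl fun T hT => ?_
      have hT' : t + 1 ∉ T := fun h => hnot (Finset.mem_powerset.1 hT h)
      by_cases h : t ∈ T <;>
        simp [fenceClosed_succ_iff ht, fenceClosed_insert_succ_iff, hT', hε, h, h1t,
          Finset.prod_insert]
    · rw [← Finset.sum_add_distrib, ← Finset.sum_add_distrib, Finset.mul_sum]
      refine Finset.sum_congr rfl fun T hT => ?_
      have hT' : t + 1 ∉ T := fun h => hnot (Finset.mem_powerset.1 hT h)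
      by_cases h : t ∈ T <;>
        simp [fenceClosed_succ_iff ht, fenceClosed_insert_succ_iff, hT', hε, h, h1t,
          Finset.prod_insert]

theorem fenceEnds_one (u : ℕ → K) (ε : ℕ → Bool) (s s' : Prop) :
    fenceEnds u 1 ε s s' = if s ↔ s' then (if s then u 1 else 1) else 0 := by
  have hc : ∀ T, FenceClosed 1 ε T := fun T i hi hit => by omega
  have hp : (Finset.Icc 1 1).powerset = ({∅, {1}} : Finset (Finset ℕ)) := by
    ext T
    simp [Finset.subset_singleton_iff]
  unfold fenceEnds fenceSum
  rw [hp, Finset.sum_pair (by simp)]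
  by_cases h : s <;> by_cases h' : s' <;> simp [hc, h, h']

/-- The transfer matrix of a fence has determinant the product of the weights. -/
theorem fenceEnds_det {t : ℕ} (ht : 1 ≤ t) (u : ℕ → K) (ε : ℕ → Bool) :
    fenceEnds u t ε False False * fenceEnds u t ε True True =
      fenceEnds u t ε False True * fenceEnds u t ε True False +
        ∏ i ∈ Finset.Icc 1 t, u i := by
  induction t, ht using Nat.le_induction with
  | base => simp [fenceEnds_one]
  | succ t ht ih =>
    rw [Finset.prod_Icc_succ_top (by omega), (fenceEnds_succ ht u ε False).1,
      (fenceEnds_succ ht u ε False).2, (fenceEnds_succ ht u ε True).1,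
      (fenceEnds_succ ht u ε True).2]
    generalize fenceEnds u t ε False False = p at *
    generalize fenceEnds u t ε False True = q at *
    generalize fenceEnds u t ε True False = r at *
    generalize fenceEnds u t ε True True = v at *
    split_ifs
    · calc (p + q) * (u (t + 1) * v) = u (t + 1) * (p * v) + u (t + 1) * (q * v) := by ring
        _ = _ := by rw [ih]; ring
    · calc p * (u (t + 1) * (r + v)) = u (t + 1) * (p * v) + u (t + 1) * (p * r) := by ring
        _ = _ := by rw [ih]; ring

/-- Grouping the down-sets of the fence according to the presence of its ends. -/
theorem sum_fence_eq_ends (u : ℕ → K) (t : ℕ) (ε : ℕ → Bool) (L M : Prop → K) :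
    ∑ T ∈ (Finset.Icc 1 t).powerset,
        (if FenceClosed t ε T then L (1 ∈ T) * (∏ i ∈ T, u i) * M (t ∈ T) else 0) =
      L False * fenceEnds u t ε False False * M False +
        L False * fenceEnds u t ε False True * M True +
        L True * fenceEnds u t ε True False * M False +
        L True * fenceEnds u t ε True True * M True := by
  unfold fenceEnds fenceSum
  simp only [Finset.mul_sum, Finset.sum_mul, ← Finset.sum_add_distrib]
  refine Finset.sum_congr rfl fun T _ => ?_
  by_cases h : FenceClosed t ε T <;> by_cases h1 : 1 ∈ T <;> by_cases h2 : t ∈ T <;>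
    simp [h, h1, h2]

end Fence

section Closure

variable {α A : Type*}

/-- The generating relation attaching `p` below (`b = true`) or above (`b = false`) `q`. -/
def linkRel (b : Bool) (p q : α) : α → α → Prop :=
  if b then covRel p q else covRel q p

theorem linkRel_closed_iff {G U : Finset α} {f : A → α} {r : α} {a : A} {s : Prop}
    {S : Finset A} (c : Bool) (hfG : f a ∈ G) (hrG : r ∈ G)
    (hf : f a ∈ U ↔ a ∈ S) (hr : r ∈ U ↔ s) :
    (∀ x ∈ G, ∀ y ∈ U, linkRel c (f a) r x y → x ∈ U) ↔ linkCond c a s S := by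
  cases c
  · simp only [linkRel, linkCond, covRel, Bool.false_eq_true, if_false]
    constructor
    · exact fun h ha => hr.1 (h _ hrG _ (hf.2 ha) ⟨rfl, rfl⟩)
    · rintro h x - y hy ⟨rfl, rfl⟩
      exact hr.2 (h (hf.1 hy))
  · simp only [linkRel, linkCond, covRel, if_true]
    constructor
    · exact fun h hs => hf.1 (h _ hfG _ (hr.2 hs) ⟨rfl, rfl⟩)
    · rintro h x - y hy ⟨rfl, rfl⟩
      exact hf.2 (h (hr.1 hy))

theorem posetRel_closed_iff {G U : Finset α} [PartialOrder A] {f : A → α} {S : Finset A}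
    (hfG : ∀ x, f x ∈ G) (hf : ∀ x, f x ∈ U ↔ x ∈ S) :
    (∀ x ∈ G, ∀ y ∈ U, posetRel f x y → x ∈ U) ↔ IsLowerSet (S : Set A) := by
  constructor
  · exact fun h x y hyx hx =>
      (hf y).1 (h _ (hfG y) _ ((hf x).2 hx) ⟨y, x, hyx, rfl, rfl⟩)
  · rintro h x - y hy ⟨p, q, hpq, rfl, rfl⟩
    exact (hf p).2 (h hpq ((hf q).1 hy))

theorem fenceRel_closed_iff {G U : Finset α} {e : ℕ → α} {t : ℕ} {T : Finset ℕ}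
    (ε : ℕ → Bool) (heG : ∀ i ∈ Finset.Icc 1 t, e i ∈ G) (he : ∀ i, e i ∈ U ↔ i ∈ T) :
    (∀ x ∈ G, ∀ y ∈ U, fenceRel e t ε x y → x ∈ U) ↔ FenceClosed t ε T := by
  constructor
  · intro h i hi hit
    refine ⟨fun hε hT => ?_, fun hε hT => ?_⟩
    · exact (he _).1 (h _ (heG i (Finset.mem_Icc.2 ⟨hi, by omega⟩)) _ ((he _).2 hT)
        ⟨i, hi, hit, .inl ⟨hε, rfl, rfl⟩⟩)
    · exact (he _).1 (h _ (heG (i + 1) (Finset.mem_Icc.2 ⟨by omega, hit⟩)) _ ((he _).2 hT)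
        ⟨i, hi, hit, .inr ⟨hε, rfl, rfl⟩⟩)
  · rintro h x - y hy ⟨i, hi, hit, ⟨hε, rfl, rfl⟩ | ⟨hε, rfl, rfl⟩⟩
    · exact (he _).2 ((h i hi hit).1 hε ((he _).1 hy))
    · exact (he _).2 ((h i hi hit).2 hε ((he _).1 hy))

theorem sup_closed_iff {G U : Finset α} (q q' : α → α → Prop) :
    (∀ x ∈ G, ∀ y ∈ U, (q ⊔ q') x y → x ∈ U) ↔
      (∀ x ∈ G, ∀ y ∈ U, q x y → x ∈ U) ∧ (∀ x ∈ G, ∀ y ∈ U, q' x y → x ∈ U) := by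
  constructor
  · exact fun h => ⟨fun x hx y hy hq => h x hx y hy (.inl hq),
      fun x hx y hy hq => h x hx y hy (.inr hq)⟩
  · rintro ⟨h, h'⟩ x hx y hy (hq | hq)
    · exact h x hx y hy hq
    · exact h' x hx y hy hq

end Closure

section Configurations

variable {α A B K : Type*} [Fintype A] [PartialOrder A] [Fintype B] [PartialOrder B]
  [CommSemiring K]

theorem idealSum_eq_sum_ite (ground : Finset α) (rel : α → α → Prop) (w : α → K) :
    idealSum ground rel w = ∑ S ∈ ground.powerset,
      if (∀ x ∈ ground, ∀ y ∈ S, rel x y → x ∈ S) then ∏ x ∈ S, w x else 0 := by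
  rw [idealSum, Finset.sum_filter]
  exact Finset.sum_congr rfl fun S _ => by congr

theorem tails_closed_iff {f : A → α} {g : B → α}
    (hf : Function.Injective f) (hg : Function.Injective g) (hfg : ∀ x y, f x ≠ g y)
    (a : A) (b : B) (S : Finset A) (V : Finset B) :
    (∀ x ∈ posetGround f ∪ posetGround g, ∀ y ∈ S.image f ∪ V.image g,
        (posetRel f ⊔ posetRel g ⊔ covRel (g b) (f a)) x y → x ∈ S.image f ∪ V.image g) ↔
      (IsLowerSet (S : Set A) ∧ IsLowerSet (V : Set B)) ∧ (a ∈ S → b ∈ V) := by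
  have hgf : ∀ x y, g x ≠ f y := fun x y h => hfg y x h.symm
  have hfm : ∀ x, f x ∈ S.image f ∪ V.image g ↔ x ∈ S := fun x => by
    simp [hf.eq_iff, hgf]
  have hgm : ∀ x, g x ∈ S.image f ∪ V.image g ↔ x ∈ V := fun x => by
    simp [hg.eq_iff, hfg]
  generalize S.image f ∪ V.image g = U at *
  have hfG : ∀ x, f x ∈ posetGround f ∪ posetGround g := fun x => by simp [posetGround]
  have hgG : ∀ x, g x ∈ posetGround f ∪ posetGround g := fun x => by simp [posetGround]
  generalize posetGround f ∪ posetGround g = G at *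
  have hlink : covRel (g b) (f a) = linkRel false (f a) (g b) := rfl
  rw [hlink, sup_closed_iff, sup_closed_iff, posetRel_closed_iff hfG hfm,
    posetRel_closed_iff hgG hgm, linkRel_closed_iff false (hfG a) (hgG b) (hfm a) (hgm b)]
  simp [linkCond]

/-- The ideal sum of two tails, one attached below the other. -/
theorem idealSum_tails {f : A → α} {g : B → α}
    (hf : Function.Injective f) (hg : Function.Injective g) (hfg : ∀ x y, f x ≠ g y)
    (a : A) (b : B) (w : α → K) :
    idealSum (posetGround f ∪ posetGround g)
        (posetRel f ⊔ posetRel g ⊔ covRel (g b) (f a)) w =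
      lowerSum (w ∘ f) (fun S => a ∈ S) * lowerSum (w ∘ g) (fun S => b ∈ S) +
        lowerSum (w ∘ f) (fun S => a ∉ S) *
          (lowerSum (w ∘ g) (fun S => b ∈ S) + lowerSum (w ∘ g) (fun S => b ∉ S)) := by
  have hd : ∀ (S : Finset A) (V : Finset B), Disjoint (S.image f) (V.image g) :=
    disjoint_image_image_of_forall_ne hfg
  rw [idealSum_eq_sum_ite, posetGround, posetGround, sum_powerset_union_of_disjoint (hd _ _),
    sum_powerset_image_of_injective hf]
  simp only [sum_powerset_image_of_injective hg, Finset.powerset_univ]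
  rw [← lowerSum_true]
  unfold lowerSum
  simp only [Finset.sum_mul_sum, ← Finset.sum_add_distrib]
  refine Finset.sum_congr rfl fun S _ => Finset.sum_congr rfl fun V _ => ?_
  have key := tails_closed_iff hf hg hfg a b S V
  simp only [posetGround] at key
  rw [if_congr key rfl rfl, Finset.prod_union (hd _ _), Finset.prod_image hf.injOn,
    Finset.prod_image hg.injOn]
  by_cases h1 : IsLowerSet (S : Set A) <;> by_cases h2 : IsLowerSet (V : Set B) <;>
    by_cases h3 : a ∈ S <;> by_cases h4 : b ∈ V <;> simp [h1, h2, h3, h4]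

/-- The ideal sum of a fence with a tail attached at each end, by the transfer matrix. -/
theorem idealSum_fence_tails {f : A → α} {e : ℕ → α} {g : B → α}
    (hf : Function.Injective f) (he : Function.Injective e) (hg : Function.Injective g)
    (hfe : ∀ x i, f x ≠ e i) (hfg : ∀ x y, f x ≠ g y) (heg : ∀ i y, e i ≠ g y)
    {t : ℕ} (ht : 1 ≤ t) (ε : ℕ → Bool) (c d : Bool) (a : A) (b : B) (w : α → K) :
    idealSum (posetGround f ∪ natGround e 1 t ∪ posetGround g)
        (posetRel f ⊔ posetRel g ⊔ fenceRel e t ε ⊔ linkRel c (f a) (e 1) ⊔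
          linkRel d (g b) (e t)) w =
      tailSum (w ∘ f) c a False * fenceEnds (w ∘ e) t ε False False *
            tailSum (w ∘ g) d b False +
          tailSum (w ∘ f) c a False * fenceEnds (w ∘ e) t ε False True *
            tailSum (w ∘ g) d b True +
          tailSum (w ∘ f) c a True * fenceEnds (w ∘ e) t ε True False *
            tailSum (w ∘ g) d b False +
          tailSum (w ∘ f) c a True * fenceEnds (w ∘ e) t ε True True *
            tailSum (w ∘ g) d b True := by
  have hef : ∀ i x, e i ≠ f x := fun i x h => hfe x i h.symm
  have hgf : ∀ y x, g y ≠ f x := fun y x h => hfg x y h.symm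
  have hge : ∀ y i, g y ≠ e i := fun y i h => heg i y h.symm
  have hd : ∀ (S : Finset A) (T : Finset ℕ), Disjoint (S.image f) (T.image e) :=
    disjoint_image_image_of_forall_ne hfe
  have hd' : ∀ (S : Finset A) (T : Finset ℕ) (V : Finset B),
      Disjoint (S.image f ∪ T.image e) (V.image g) := fun S T V =>
    Finset.disjoint_union_left.2 ⟨disjoint_image_image_of_forall_ne hfg S V,
      disjoint_image_image_of_forall_ne heg T V⟩
  rw [idealSum_eq_sum_ite, ← sum_fence_eq_ends (w ∘ e) t ε (tailSum (w ∘ f) c a)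
    (tailSum (w ∘ g) d b)]
  generalize hG : posetGround f ∪ natGround e 1 t ∪ posetGround g = G
  have hfG : ∀ x, f x ∈ G := fun x => by simp [← hG, posetGround]
  have hgG : ∀ x, g x ∈ G := fun x => by simp [← hG, posetGround]
  have heG : ∀ i ∈ Finset.Icc 1 t, e i ∈ G := fun i hi => by
    rw [← hG]
    exact Finset.mem_union_left _ (Finset.mem_union_right _ (Finset.mem_image_of_mem e hi))
  have key : ∀ (S : Finset A) (T : Finset ℕ) (V : Finset B),
      (∀ x ∈ G, ∀ y ∈ S.image f ∪ T.image e ∪ V.image g,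
        (posetRel f ⊔ posetRel g ⊔ fenceRel e t ε ⊔ linkRel c (f a) (e 1) ⊔
          linkRel d (g b) (e t)) x y → x ∈ S.image f ∪ T.image e ∪ V.image g) ↔
      (((IsLowerSet (S : Set A) ∧ IsLowerSet (V : Set B)) ∧ FenceClosed t ε T) ∧
        linkCond c a (1 ∈ T) S) ∧ linkCond d b (t ∈ T) V := by
    intro S T V
    have hfm : ∀ x, f x ∈ S.image f ∪ T.image e ∪ V.image g ↔ x ∈ S := fun x => by
      simp [hf.eq_iff, hgf, hef]
    have hem : ∀ x, e x ∈ S.image f ∪ T.image e ∪ V.image g ↔ x ∈ T := fun x => by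
      simp [he.eq_iff, hge, hfe]
    have hgm : ∀ x, g x ∈ S.image f ∪ T.image e ∪ V.image g ↔ x ∈ V := fun x => by
      simp [hg.eq_iff, hfg, heg]
    rw [sup_closed_iff, sup_closed_iff, sup_closed_iff, sup_closed_iff,
      posetRel_closed_iff hfG hfm, posetRel_closed_iff hgG hgm, fenceRel_closed_iff ε heG hem,
      linkRel_closed_iff c (hfG a) (heG 1 (Finset.mem_Icc.2 ⟨le_rfl, ht⟩)) (hfm a) (hem 1),
      linkRel_closed_iff d (hgG b) (heG t (Finset.mem_Icc.2 ⟨ht, le_rfl⟩)) (hgm b) (hem t)]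
  have hsplit : ∀ F : Finset α → K, ∑ U ∈ G.powerset, F U =
      ∑ T ∈ (Finset.Icc 1 t).powerset, ∑ S : Finset A, ∑ V : Finset B,
        F (S.image f ∪ T.image e ∪ V.image g) := by
    intro F
    rw [← hG, posetGround, natGround, posetGround, sum_powerset_union_of_disjoint (hd' _ _ _),
      sum_powerset_union_of_disjoint (hd _ _), sum_powerset_image_of_injective hf]
    simp only [sum_powerset_image_of_injective he, sum_powerset_image_of_injective hg,
      Finset.powerset_univ]
    rw [Finset.sum_comm]
  rw [hsplit]
  refine Finset.sum_congr rfl fun T _ => ?_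
  have hterm : ∀ (S : Finset A) (V : Finset B),
      (if (∀ x ∈ G, ∀ y ∈ S.image f ∪ T.image e ∪ V.image g,
        (posetRel f ⊔ posetRel g ⊔ fenceRel e t ε ⊔ linkRel c (f a) (e 1) ⊔
          linkRel d (g b) (e t)) x y → x ∈ S.image f ∪ T.image e ∪ V.image g) then
          ∏ x ∈ S.image f ∪ T.image e ∪ V.image g, w x else 0) =
        if FenceClosed t ε T then
          (if IsLowerSet (S : Set A) ∧ linkCond c a (1 ∈ T) S then ∏ x ∈ S, (w ∘ f) x else 0) *
            (∏ i ∈ T, (w ∘ e) i) *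
            (if IsLowerSet (V : Set B) ∧ linkCond d b (t ∈ T) V then ∏ x ∈ V, (w ∘ g) x else 0)
        else 0 := by
    intro S V
    rw [if_congr (key S T V) rfl rfl, Finset.prod_union (hd' _ _ _), Finset.prod_union (hd _ _),
      Finset.prod_image hf.injOn, Finset.prod_image he.injOn, Finset.prod_image hg.injOn]
    by_cases h1 : IsLowerSet (S : Set A) <;> by_cases h2 : IsLowerSet (V : Set B) <;>
      by_cases h3 : linkCond c a (1 ∈ T) S <;> by_cases h4 : linkCond d b (t ∈ T) V <;>
      simp [h1, h2, h3, h4]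
  simp only [hterm]
  split_ifs with hT
  · simp only [tailSum, lowerSum, Finset.sum_mul, Finset.mul_sum]
    rw [Finset.sum_comm]
  · simp

/-- The bilinear identity behind the skein relation: `!![p, q; r, v]` is a
transfer matrix of determinant `z`, contracted with the tail vectors. -/
theorem transfer_skein_identity {p q r v z : K} (h : p * v = q * r + z)
    (i₁ o₁ i₂ o₂ j₁ k₁ j₂ k₂ : K) :
    ((i₁ + o₁) * p * (j₁ + k₁) + (i₁ + o₁) * q * j₁ + i₁ * r * (j₁ + k₁) + i₁ * v * j₁) *
        (o₂ * p * k₂ + o₂ * q * (j₂ + k₂) + (i₂ + o₂) * r * k₂ + (i₂ + o₂) * v * (j₂ + k₂)) =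
      ((i₁ + o₁) * p * k₂ + (i₁ + o₁) * q * (j₂ + k₂) + i₁ * r * k₂ + i₁ * v * (j₂ + k₂)) *
          (o₂ * p * (j₁ + k₁) + o₂ * q * j₁ + (i₂ + o₂) * r * (j₁ + k₁) + (i₂ + o₂) * v * j₁) +
        z * ((i₁ * i₂ + o₁ * (i₂ + o₂)) * (j₁ * j₂ + k₁ * (j₂ + k₂))) := by
  let C : K := (i₁ + o₁) * o₂ * (p * (j₁ + k₁) + q * j₁) * (p * k₂ + q * (j₂ + k₂)) +
    i₁ * (i₂ + o₂) * (r * (j₁ + k₁) + v * j₁) * (r * k₂ + v * (j₂ + k₂)) +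
    p * r * (j₁ + k₁) * k₂ * ((i₁ + o₁) * (i₂ + o₂) + i₁ * o₂) +
    q * v * j₁ * (j₂ + k₂) * ((i₁ + o₁) * (i₂ + o₂) + i₁ * o₂)
  let X : K := (i₁ + o₁) * (i₂ + o₂) * ((j₁ + k₁) * (j₂ + k₂)) + i₁ * o₂ * (j₁ * k₂)
  let Y : K := (i₁ + o₁) * (i₂ + o₂) * (j₁ * k₂) + i₁ * o₂ * ((j₁ + k₁) * (j₂ + k₂))
  calc
    _ = C + (p * v) * X + q * r * Y := by
      simp only [C, X, Y]
      ring
    _ = C + (p * v) * Y + q * r * X +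
        z * ((i₁ * i₂ + o₁ * (i₂ + o₂)) * (j₁ * j₂ + k₁ * (j₂ + k₂))) := by
      simp only [h, C, X, Y]
      ring
    _ = _ := by
      simp only [C, X, Y]
      ring

end Configurations

theorem skein_type0_transverse_crossing
    (K : Type*) [CommSemiring K]
    (t : ℕ) (ht : 1 ≤ t) (ε : ℕ → Bool)
    (A₁ B₁ A₂ B₂ : Type*)
    [Fintype A₁] [PartialOrder A₁] [Fintype B₁] [PartialOrder B₁]
    [Fintype A₂] [PartialOrder A₂] [Fintype B₂] [PartialOrder B₂]
    (a₁ : A₁) (b₁ : B₁) (a₂ : A₂) (b₂ : B₂)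
    (u : ℕ → K) (w₁ : A₁ → K) (x₁ : B₁ → K) (w₂ : A₂ → K) (x₂ : B₂ → K) :
    -- Z(P₁) · Z(P₂)
    idealSum
        (posetGround (eA1 A₁ B₁ A₂ B₂) ∪ natGround (eR A₁ B₁ A₂ B₂) 1 t ∪
          posetGround (eB1 A₁ B₁ A₂ B₂))
        (posetRel (eA1 A₁ B₁ A₂ B₂) ⊔ posetRel (eB1 A₁ B₁ A₂ B₂) ⊔
          fenceRel (eR A₁ B₁ A₂ B₂) t ε ⊔
          covRel (eA1 A₁ B₁ A₂ B₂ a₁) (eR A₁ B₁ A₂ B₂ 1) ⊔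
          covRel (eB1 A₁ B₁ A₂ B₂ b₁) (eR A₁ B₁ A₂ B₂ t))
        (Sum.elim w₁ (Sum.elim x₁ (Sum.elim w₂ (Sum.elim x₂ u)))) *
      idealSum
        (posetGround (eA2 A₁ B₁ A₂ B₂) ∪ natGround (eR A₁ B₁ A₂ B₂) 1 t ∪
          posetGround (eB2 A₁ B₁ A₂ B₂))
        (posetRel (eA2 A₁ B₁ A₂ B₂) ⊔ posetRel (eB2 A₁ B₁ A₂ B₂) ⊔
          fenceRel (eR A₁ B₁ A₂ B₂) t ε ⊔
          covRel (eR A₁ B₁ A₂ B₂ 1) (eA2 A₁ B₁ A₂ B₂ a₂) ⊔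
          covRel (eR A₁ B₁ A₂ B₂ t) (eB2 A₁ B₁ A₂ B₂ b₂))
        (Sum.elim w₁ (Sum.elim x₁ (Sum.elim w₂ (Sum.elim x₂ u))))
    -- = Z(P₃) · Z(P₄) + (∏ u) · Z(P₅) · Z(P₆)
    = idealSum
        (posetGround (eA1 A₁ B₁ A₂ B₂) ∪ natGround (eR A₁ B₁ A₂ B₂) 1 t ∪
          posetGround (eB2 A₁ B₁ A₂ B₂))
        (posetRel (eA1 A₁ B₁ A₂ B₂) ⊔ posetRel (eB2 A₁ B₁ A₂ B₂) ⊔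
          fenceRel (eR A₁ B₁ A₂ B₂) t ε ⊔
          covRel (eA1 A₁ B₁ A₂ B₂ a₁) (eR A₁ B₁ A₂ B₂ 1) ⊔
          covRel (eR A₁ B₁ A₂ B₂ t) (eB2 A₁ B₁ A₂ B₂ b₂))
        (Sum.elim w₁ (Sum.elim x₁ (Sum.elim w₂ (Sum.elim x₂ u)))) *
      idealSum
        (posetGround (eA2 A₁ B₁ A₂ B₂) ∪ natGround (eR A₁ B₁ A₂ B₂) 1 t ∪
          posetGround (eB1 A₁ B₁ A₂ B₂))
        (posetRel (eA2 A₁ B₁ A₂ B₂) ⊔ posetRel (eB1 A₁ B₁ A₂ B₂) ⊔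
          fenceRel (eR A₁ B₁ A₂ B₂) t ε ⊔
          covRel (eR A₁ B₁ A₂ B₂ 1) (eA2 A₁ B₁ A₂ B₂ a₂) ⊔
          covRel (eB1 A₁ B₁ A₂ B₂ b₁) (eR A₁ B₁ A₂ B₂ t))
        (Sum.elim w₁ (Sum.elim x₁ (Sum.elim w₂ (Sum.elim x₂ u))))
      + (∏ i ∈ Finset.Icc 1 t, u i) *
        (idealSum
            (posetGround (eA1 A₁ B₁ A₂ B₂) ∪ posetGround (eA2 A₁ B₁ A₂ B₂))
            (posetRel (eA1 A₁ B₁ A₂ B₂) ⊔ posetRel (eA2 A₁ B₁ A₂ B₂) ⊔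
              covRel (eA2 A₁ B₁ A₂ B₂ a₂) (eA1 A₁ B₁ A₂ B₂ a₁))
            (Sum.elim w₁ (Sum.elim x₁ (Sum.elim w₂ (Sum.elim x₂ u)))) *
          idealSum
            (posetGround (eB1 A₁ B₁ A₂ B₂) ∪ posetGround (eB2 A₁ B₁ A₂ B₂))
            (posetRel (eB1 A₁ B₁ A₂ B₂) ⊔ posetRel (eB2 A₁ B₁ A₂ B₂) ⊔
              covRel (eB2 A₁ B₁ A₂ B₂ b₂) (eB1 A₁ B₁ A₂ B₂ b₁))
            (Sum.elim w₁ (Sum.elim x₁ (Sum.elim w₂ (Sum.elim x₂ u))))) := by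
  have hA₁ : Function.Injective (eA1 A₁ B₁ A₂ B₂) := fun x y h => by simpa [eA1] using h
  have hB₁ : Function.Injective (eB1 A₁ B₁ A₂ B₂) := fun x y h => by simpa [eB1] using h
  have hA₂ : Function.Injective (eA2 A₁ B₁ A₂ B₂) := fun x y h => by simpa [eA2] using h
  have hB₂ : Function.Injective (eB2 A₁ B₁ A₂ B₂) := fun x y h => by simpa [eB2] using h
  have hR : Function.Injective (eR A₁ B₁ A₂ B₂) := fun x y h => by simpa [eR] using h
  generalize hw : (Sum.elim w₁ (Sum.elim x₁ (Sum.elim w₂ (Sum.elim x₂ u)))) = w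
  have hwR : w ∘ eR A₁ B₁ A₂ B₂ = u := by subst hw; rfl
  have h1 := idealSum_fence_tails hA₁ hR hB₁ (by simp [eA1, eR]) (by simp [eA1, eB1])
    (by simp [eR, eB1]) ht ε true true a₁ b₁ w
  have h2 := idealSum_fence_tails hA₂ hR hB₂ (by simp [eA2, eR]) (by simp [eA2, eB2])
    (by simp [eR, eB2]) ht ε false false a₂ b₂ w
  have h3 := idealSum_fence_tails hA₁ hR hB₂ (by simp [eA1, eR]) (by simp [eA1, eB2])
    (by simp [eR, eB2]) ht ε true false a₁ b₂ w
  have h4 := idealSum_fence_tails hA₂ hR hB₁ (by simp [eA2, eR]) (by simp [eA2, eB1])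
    (by simp [eR, eB1]) ht ε false true a₂ b₁ w
  have h5 := idealSum_tails hA₁ hA₂ (by simp [eA1, eA2]) a₁ a₂ w
  have h6 := idealSum_tails hB₁ hB₂ (by simp [eB1, eB2]) b₁ b₂ w
  simp only [linkRel, if_true, Bool.false_eq_true, if_false, tailSum_below_true,
    tailSum_below_false, tailSum_above_true, tailSum_above_false, hwR] at h1 h2 h3 h4
  have key := transfer_skein_identity (fenceEnds_det ht u ε)
    (lowerSum (w ∘ eA1 A₁ B₁ A₂ B₂) (fun S => a₁ ∈ S))
    (lowerSum (w ∘ eA1 A₁ B₁ A₂ B₂) (fun S => a₁ ∉ S))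
    (lowerSum (w ∘ eA2 A₁ B₁ A₂ B₂) (fun S => a₂ ∈ S))
    (lowerSum (w ∘ eA2 A₁ B₁ A₂ B₂) (fun S => a₂ ∉ S))
    (lowerSum (w ∘ eB1 A₁ B₁ A₂ B₂) (fun S => b₁ ∈ S))
    (lowerSum (w ∘ eB1 A₁ B₁ A₂ B₂) (fun S => b₁ ∉ S))
    (lowerSum (w ∘ eB2 A₁ B₁ A₂ B₂) (fun S => b₂ ∈ S))
    (lowerSum (w ∘ eB2 A₁ B₁ A₂ B₂) (fun S => b₂ ∉ S))
  rw [← h1, ← h2, ← h3, ← h4, ← h5, ← h6] at key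
  convert key
end
end
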